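/- Let r₀ > 0 and r₁ > 0, and let R : [0,T*) → ℝ be the maximal positive solution of the ordinary differential equation R''(t) = −1/R(t) with R(0) = r₀ and R'(0) = r₁. Then T* is finite, R(t) → 0 as t → T*, and there exists t₁ ∈ (0,T*) such that R is strictly increasing on [0,t₁] and strictly decreasing on [t₁,T*): that is, R'(t) > 0 for t ∈ [0,t₁), R'(t₁) = 0, and R'(t) < 0 for t ∈ (t₁,T*). -/

import Mathlib

open Real Set Filter Topology

/-- `R` is a positive solution of `R'' = −1/R`, `R(0) = r₀`, `R'(0) = r₁` on `[0, T)`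
(where the endpoint `T` is an extended real, so `T = ⊤` means a global solution). -/
def IsCircleSol (r₀ r₁ : ℝ) (T : EReal) (R : ℝ → ℝ) : Prop :=
  R 0 = r₀ ∧ deriv R 0 = r₁ ∧
  ∀ t : ℝ, 0 ≤ t → (t : EReal) < T →
    0 < R t ∧ DifferentiableAt ℝ R t ∧ DifferentiableAt ℝ (deriv R) t ∧
    deriv (deriv R) t = -(1 / R t)

/-- The time at which the circle, started with velocity `r` and with conserved quantity
`M = R * exp (R' ^ 2 / 2)`, has velocity `v`. -/
noncomputable def circleTime (M r v : ℝ) : ℝ := M * ∫ s in v..r, exp (-(1 / 2) * s ^ 2)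

theorem circleTime_self (M r : ℝ) : circleTime M r r = 0 := by simp [circleTime]

theorem hasStrictDerivAt_circleTime (M r v : ℝ) :
    HasStrictDerivAt (circleTime M r) (-(M * exp (-(1 / 2) * v ^ 2))) v := by
  have hc : Continuous fun s : ℝ => exp (-(1 / 2) * s ^ 2) := by fun_prop
  have h := intervalIntegral.integral_hasStrictDerivAt_left (hc.intervalIntegrable v r)
    (hc.stronglyMeasurableAtFilter _ _) hc.continuousAt
  exact mul_neg M _ ▸ h.const_mul M

theorem continuous_circleTime (M r : ℝ) : Continuous (circleTime M r) :=
  continuous_iff_continuousAt.2 fun v => (hasStrictDerivAt_circleTime M r v).hasDerivAt.continuousAt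

theorem strictAnti_circleTime {M : ℝ} (hM : 0 < M) (r : ℝ) : StrictAnti (circleTime M r) :=
  strictAnti_of_deriv_neg fun v => by
    rw [(hasStrictDerivAt_circleTime M r v).hasDerivAt.deriv]
    have := mul_pos hM (exp_pos (-(1 / 2) * v ^ 2))
    linarith

theorem tendsto_circleTime_atBot (M r : ℝ) :
    Tendsto (circleTime M r) atBot
      (𝓝 (M * ∫ s in Iic r, exp (-(1 / 2) * s ^ 2))) :=
  (MeasureTheory.intervalIntegral_tendsto_integral_Iic r
    (integrable_exp_neg_mul_sq (by norm_num : (0 : ℝ) < 1 / 2)).integrableOn tendsto_id).const_mul M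

theorem circleTime_lt {M : ℝ} (hM : 0 < M) (r v : ℝ) :
    circleTime M r v < M * ∫ s in Iic r, exp (-(1 / 2) * s ^ 2) :=
  (strictAnti_circleTime hM r (by linarith : v - 1 < v)).trans_le
    ((strictAnti_circleTime hM r).antitone.ge_of_tendsto (tendsto_circleTime_atBot M r) _)

theorem exists_circleTime_eq {M r t : ℝ} (ht : 0 ≤ t)
    (ht' : t < M * ∫ s in Iic r, exp (-(1 / 2) * s ^ 2)) : ∃ v, circleTime M r v = t := by
  obtain ⟨u, hu⟩ := ((tendsto_circleTime_atBot M r).eventually (eventually_gt_nhds ht')).exists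
  exact mem_range_of_exists_le_of_exists_ge (continuous_circleTime M r)
    ⟨r, by rwa [circleTime_self]⟩ ⟨u, hu.le⟩

/-- The explicit solution, obtained by inverting `circleTime`. -/
theorem exists_isCircleSol {r₀ : ℝ} (hr₀ : 0 < r₀) (r₁ : ℝ) :
    ∃ Q : ℝ → ℝ, IsCircleSol r₀ r₁
      ((r₀ * exp (1 / 2 * r₁ ^ 2) * ∫ s in Iic r₁, exp (-(1 / 2) * s ^ 2) : ℝ) : EReal) Q := by
  set M := r₀ * exp (1 / 2 * r₁ ^ 2) with hMdef
  have hM : 0 < M := by positivity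
  set w := Function.invFun (circleTime M r₁)
  have hw : ∀ v, w (circleTime M r₁ v) = v :=
    Function.leftInverse_invFun (strictAnti_circleTime hM r₁).injective
  have hne : ∀ v : ℝ, -(M * exp (-(1 / 2) * v ^ 2)) ≠ 0 := fun v => by
    have := mul_pos hM (exp_pos (-(1 / 2) * v ^ 2))
    linarith
  have hwd : ∀ v, HasDerivAt w (-(M * exp (-(1 / 2) * v ^ 2)))⁻¹ (circleTime M r₁ v) := fun v =>
    ((hasStrictDerivAt_circleTime M r₁ v).to_local_left_inverse (hne v)
      (Eventually.of_forall hw)).hasDerivAt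
  set Q : ℝ → ℝ := fun t => M * exp (-(1 / 2) * w t ^ 2) with hQ
  have hQd : ∀ v, HasDerivAt Q v (circleTime M r₁ v) := fun v => by
    have h := ((((hwd v).pow 2).const_mul (-(1 / 2))).exp).const_mul M
    simp only [Pi.pow_apply, hw] at h
    refine h.congr_deriv ?_
    have h1 := hM.ne'
    have h2 := (exp_pos (-(1 / 2) * v ^ 2)).ne'
    field_simp
    norm_num
  have hQd' : ∀ v, deriv Q =ᶠ[𝓝 (circleTime M r₁ v)] w := fun v => by
    rw [← (hasStrictDerivAt_circleTime M r₁ v).map_nhds_eq (hne v)]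
    exact Filter.eventually_map.2 (Eventually.of_forall fun u => by rw [(hQd u).deriv, hw])
  have h0 : w 0 = r₁ := by rw [← circleTime_self M r₁, hw]
  refine ⟨Q, ?_, ?_, fun t ht htT => ?_⟩
  · simp only [hQ, h0, hMdef, mul_assoc, ← exp_add]
    simp
  · rw [← circleTime_self M r₁, (hQd r₁).deriv]
  · obtain ⟨v, rfl⟩ := exists_circleTime_eq ht (EReal.coe_lt_coe_iff.1 htT)
    have hd := (hwd v).congr_of_eventuallyEq (hQd' v)
    refine ⟨by positivity, (hQd v).differentiableAt, hd.differentiableAt, ?_⟩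
    rw [hd.deriv]
    simp only [hQ, hw, inv_neg, one_div]

theorem eq_of_hasDerivAt_zero {T : EReal} {f : ℝ → ℝ}
    (hf : ∀ t : ℝ, 0 ≤ t → (t : EReal) < T → HasDerivAt f 0 t)
    {t : ℝ} (ht : 0 ≤ t) (htT : (t : EReal) < T) : f t = f 0 := by
  have hlt : ∀ s ≤ t, (s : EReal) < T := fun s hs => (EReal.coe_le_coe_iff.2 hs).trans_lt htT
  exact constant_of_has_deriv_right_zero
    (fun s hs => (hf s hs.1 (hlt s hs.2)).continuousAt.continuousWithinAt)
    (fun s hs => (hf s hs.1 (hlt s hs.2.le)).hasDerivWithinAt) t (right_mem_Icc.2 ht)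

namespace IsCircleSol

variable {r₀ r₁ : ℝ} {T : EReal} {R : ℝ → ℝ}

theorem hasDerivAt_deriv (h : IsCircleSol r₀ r₁ T R) {t : ℝ} (ht : 0 ≤ t) (htT : (t : EReal) < T) :
    HasDerivAt (deriv R) (-(1 / R t)) t := by
  obtain ⟨-, -, h2, h3⟩ := h.2.2 t ht htT
  exact h3 ▸ h2.hasDerivAt

theorem mul_exp_eq (h : IsCircleSol r₀ r₁ T R) {t : ℝ} (ht : 0 ≤ t) (htT : (t : EReal) < T) :
    R t * exp (1 / 2 * deriv R t ^ 2) = r₀ * exp (1 / 2 * r₁ ^ 2) := by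
  have key := eq_of_hasDerivAt_zero (T := T) (f := fun t => R t * exp (1 / 2 * deriv R t ^ 2))
    (fun s hs hsT => by
      obtain ⟨hp, hd, -, -⟩ := h.2.2 s hs hsT
      refine (hd.hasDerivAt.mul
        ((((h.hasDerivAt_deriv hs hsT).pow 2).const_mul (1 / 2)).exp)).congr_deriv ?_
      have := hp.ne'
      field_simp
      norm_num
      ring) ht htT
  simpa only [h.1, h.2.1] using key

theorem eq_mul_exp (h : IsCircleSol r₀ r₁ T R) {t : ℝ} (ht : 0 ≤ t) (htT : (t : EReal) < T) :
    R t = r₀ * exp (1 / 2 * r₁ ^ 2) * exp (-(1 / 2) * deriv R t ^ 2) := by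
  rw [← h.mul_exp_eq ht htT, mul_assoc, ← exp_add]
  simp

theorem circleTime_deriv (h : IsCircleSol r₀ r₁ T R) {t : ℝ} (ht : 0 ≤ t)
    (htT : (t : EReal) < T) :
    circleTime (r₀ * exp (1 / 2 * r₁ ^ 2)) r₁ (deriv R t) = t := by
  have key := eq_of_hasDerivAt_zero (T := T)
    (f := fun t => circleTime (r₀ * exp (1 / 2 * r₁ ^ 2)) r₁ (deriv R t) - t)
    (fun s hs hsT => by
      have hp := (h.2.2 s hs hsT).1.ne'
      have hd := ((hasStrictDerivAt_circleTime (r₀ * exp (1 / 2 * r₁ ^ 2)) r₁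
        (deriv R s)).hasDerivAt.comp s (h.hasDerivAt_deriv hs hsT)).sub (hasDerivAt_id s)
      rw [← h.eq_mul_exp hs hsT] at hd
      refine hd.congr_deriv ?_
      field_simp
      norm_num) ht htT
  rw [h.2.1, circleTime_self] at key
  linarith

end IsCircleSol

/-- For the hyperbolic mean curvature flow of round circles, `R'' = −1/R`, `R(0) = r₀ > 0`,
`R'(0) = r₁ > 0`: the maximal positive solution exists only on a finite interval `[0,T*)`,
`R(t) → 0` as `t → T*`, and there is `t₁ ∈ (0,T*)` such that `R` is strictly increasing
on `[0,t₁]` and strictly decreasing on `[t₁,T*)`, with `R' > 0` on `[0,t₁)`, `R'(t₁) = 0`,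
and `R' < 0` on `(t₁,T*)`. -/
theorem circle_expands_then_shrinks_positive_initial_velocity
    (r₀ r₁ : ℝ) (hr₀ : 0 < r₀) (hr₁ : 0 < r₁)
    (Tstar : EReal) (hT : 0 < Tstar) (R : ℝ → ℝ)
    (hsol : IsCircleSol r₀ r₁ Tstar R)
    (hmax : ∀ T' : ℝ, Tstar < (T' : EReal) → ¬ ∃ R' : ℝ → ℝ, IsCircleSol r₀ r₁ (T' : EReal) R') :
    ∃ T : ℝ, Tstar = (T : EReal) ∧
      Tendsto R (𝓝[<] T) (𝓝 0) ∧
      ∃ t₁ : ℝ, 0 < t₁ ∧ t₁ < T ∧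
        StrictMonoOn R (Icc 0 t₁) ∧
        StrictAntiOn R (Ico t₁ T) ∧
        (∀ t, 0 ≤ t → t < t₁ → 0 < deriv R t) ∧
        deriv R t₁ = 0 ∧
        (∀ t, t₁ < t → t < T → deriv R t < 0) := by
  set M := r₀ * exp (1 / 2 * r₁ ^ 2)
  have hM : 0 < M := by positivity
  set b := M * ∫ s in Iic r₁, exp (-(1 / 2) * s ^ 2)
  have hanti := strictAnti_circleTime hM r₁
  have hlt : ∀ v, circleTime M r₁ v < b := circleTime_lt hM r₁
  have hb0 : 0 < b := circleTime_self M r₁ ▸ hlt r₁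
  have hTb : Tstar = (b : EReal) := by
    refine le_antisymm (not_lt.1 fun hbT => ?_)
      (not_lt.1 fun hTb => hmax b hTb (exists_isCircleSol hr₀ r₁))
    exact (hlt _).ne (hsol.circleTime_deriv hb0.le hbT)
  subst hTb
  have htime : ∀ t, 0 ≤ t → t < b → circleTime M r₁ (deriv R t) = t := fun t ht htb =>
    hsol.circleTime_deriv ht (EReal.coe_lt_coe_iff.2 htb)
  have hcont : ∀ t, 0 ≤ t → t < b → ContinuousAt R t := fun t ht htb =>
    (hsol.2.2 t ht (EReal.coe_lt_coe_iff.2 htb)).2.1.continuousAt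
  have ht₁ : 0 < circleTime M r₁ 0 := by simpa only [circleTime_self] using hanti hr₁
  have hpos : ∀ t, 0 ≤ t → t < circleTime M r₁ 0 → 0 < deriv R t := fun t h0 h1 =>
    hanti.lt_iff_gt.1 (by rwa [htime t h0 (h1.trans (hlt 0))])
  have hneg : ∀ t, circleTime M r₁ 0 < t → t < b → deriv R t < 0 := fun t h0 h1 =>
    hanti.lt_iff_gt.1 (by rwa [htime t (ht₁.trans h0).le h1])
  refine ⟨b, rfl, ?_, circleTime M r₁ 0, ht₁, hlt 0, ?_, ?_, hpos, ?_, hneg⟩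
  · have hderiv : Tendsto (deriv R) (𝓝[<] b) atBot := tendsto_atBot.2 fun K => by
      filter_upwards [Ioo_mem_nhdsLT (max_lt (hlt K) hb0)] with t ht
      obtain ⟨hK, h0⟩ := max_lt_iff.1 ht.1
      exact (hanti.lt_iff_gt.1 (by rwa [htime t h0.le ht.2])).le
    have hsq : Tendsto (fun t => -(1 / 2) * deriv R t ^ 2) (𝓝[<] b) atBot := by
      simp only [sq]
      exact (hderiv.atBot_mul_atBot₀ hderiv).const_mul_atTop_of_neg (by norm_num)
    have hlim := (tendsto_exp_atBot.comp hsq).const_mul M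
    rw [mul_zero] at hlim
    refine hlim.congr' ?_
    filter_upwards [Ioo_mem_nhdsLT hb0] with t ht
    exact (hsol.eq_mul_exp ht.1.le (EReal.coe_lt_coe_iff.2 ht.2)).symm
  · refine strictMonoOn_of_deriv_pos (convex_Icc _ _)
      (fun t ht => (hcont t ht.1 (ht.2.trans_lt (hlt 0))).continuousWithinAt) fun t ht => ?_
    rw [interior_Icc] at ht
    exact hpos t ht.1.le ht.2
  · refine strictAntiOn_of_deriv_neg (convex_Ico _ _)
      (fun t ht => (hcont t (ht₁.le.trans ht.1) ht.2).continuousWithinAt) fun t ht => ?_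
    rw [interior_Ico] at ht
    exact hneg t ht.1 ht.2
  · exact hanti.injective (htime _ ht₁.le (hlt 0))
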